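/- Let A ∈ DM_loc(Ω), E, F ⊂ Ω Borel sets with L^N(E ∩ F) = 0, (∂*E) ∩ F¹ = (∂*F) ∩ E¹ = ∂*E ∩ ∂*F = ∅, and λ : Ω → [0,1] Borel. Then (A, Dχ_{E∪F})_λ = (A, Dχ_E)_λ + (A, Dχ_F)_λ as distributions. If moreover χ_E, χ_F ∈ BV_loc^{A,λ}(Ω) and ∂⁻E ∩ ∂⁻F = ∅, then |(A, Dχ_{E∪F})_λ| = |(A, Dχ_E)_λ| + |(A, Dχ_F)_λ| as measures on Ω. -/

import Mathlib

open MeasureTheory Filter Topology Metric Set ENNReal NNReal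

noncomputable section

abbrev RN (N : ℕ) := EuclideanSpace ℝ (Fin N)

/-- A real Radon measure on `Ω`, locally finite on `Ω`, given by its Jordan decomposition. -/
structure LocM (N : ℕ) (Ω : Set (RN N)) where
  pos : Measure (RN N)
  neg : Measure (RN N)
  singular : pos ⟂ₘ neg
  posNull : pos Ωᶜ = 0
  negNull : neg Ωᶜ = 0
  posLoc : ∀ x ∈ Ω, ∃ s ∈ 𝓝 x, pos s < ⊤
  negLoc : ∀ x ∈ Ω, ∃ s ∈ 𝓝 x, neg s < ⊤

namespace LocM

variable {N : ℕ} {Ω : Set (RN N)}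

/-- Integral of a real function against a (signed) local measure. -/
def intg (μ : LocM N Ω) (f : RN N → ℝ) : ℝ :=
  ∫ x, f x ∂μ.pos - ∫ x, f x ∂μ.neg

/-- Total variation measure. -/
def var (μ : LocM N Ω) : Measure (RN N) := μ.pos + μ.neg

/-- Signed value of a set. -/
def rval (μ : LocM N Ω) (s : Set (RN N)) : ℝ := (μ.pos s).toReal - (μ.neg s).toReal

end LocM

/-- A finite real Radon measure on `Ω`. -/
structure FM (N : ℕ) (Ω : Set (RN N)) where
  pos : Measure (RN N)
  neg : Measure (RN N)
  posFin : IsFiniteMeasure pos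
  negFin : IsFiniteMeasure neg
  singular : pos ⟂ₘ neg
  posNull : pos Ωᶜ = 0
  negNull : neg Ωᶜ = 0

namespace FM

variable {N : ℕ} {Ω : Set (RN N)}

def intg (μ : FM N Ω) (f : RN N → ℝ) : ℝ :=
  ∫ x, f x ∂μ.pos - ∫ x, f x ∂μ.neg

def var (μ : FM N Ω) : Measure (RN N) := μ.pos + μ.neg

def rval (μ : FM N Ω) (s : Set (RN N)) : ℝ := (μ.pos s).toReal - (μ.neg s).toReal

/-- Total variation of `Ω` (the total mass). -/
def tv (μ : FM N Ω) : ℝ := (μ.pos Set.univ).toReal + (μ.neg Set.univ).toReal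

end FM

/-- Smooth compactly supported test functions in `Ω`. -/
def IsTest {N : ℕ} (Ω : Set (RN N)) (φ : RN N → ℝ) : Prop :=
  ContDiff ℝ (⊤ : ℕ∞) φ ∧ HasCompactSupport φ ∧ tsupport φ ⊆ Ω

/-- C¹ compactly supported test functions in `Ω`. -/
def IsTest1 {N : ℕ} (Ω : Set (RN N)) (φ : RN N → ℝ) : Prop :=
  ContDiff ℝ 1 φ ∧ HasCompactSupport φ ∧ tsupport φ ⊆ Ω

/-- `i`-th partial derivative. -/
def gradComp {N : ℕ} (φ : RN N → ℝ) (i : Fin N) (x : RN N) : ℝ :=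
  fderiv ℝ φ x (EuclideanSpace.single i 1)

/-- The total variation measure `|A|` (up to equivalence) of a vector measure `A`. -/
def varSum {N : ℕ} {Ω : Set (RN N)} (A : Fin N → LocM N Ω) : Measure (RN N) :=
  ∑ i, (A i).var

def varSumF {N : ℕ} {Ω : Set (RN N)} (A : Fin N → FM N Ω) : Measure (RN N) :=
  ∑ i, (A i).var

/-- `σ` is the distributional divergence of the vector measure `A` on `Ω`. -/
def IsDivergence {N : ℕ} (Ω : Set (RN N)) (A : Fin N → LocM N Ω) (σ : LocM N Ω) : Prop :=
  ∀ φ : RN N → ℝ, IsTest Ω φ →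
    σ.intg φ = - ∑ i, (A i).intg (gradComp φ i)

def IsDivergenceF {N : ℕ} (Ω : Set (RN N)) (A : Fin N → FM N Ω) (σ : FM N Ω) : Prop :=
  ∀ φ : RN N → ℝ, IsTest Ω φ →
    σ.intg φ = - ∑ i, (A i).intg (gradComp φ i)

/-- The Lebesgue density of `E` at `x` exists and equals `d`. -/
def hasDensity {N : ℕ} (E : Set (RN N)) (x : RN N) (d : ℝ) : Prop :=
  Tendsto (fun r : ℝ => (volume (E ∩ ball x r)).toReal / (volume (ball x r)).toReal)
    (𝓝[>] 0) (𝓝 d)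

/-- Points of density 1: `E¹`. -/
def densOne {N : ℕ} (E : Set (RN N)) : Set (RN N) := {x | hasDensity E x 1}

/-- Measure-theoretic boundary `∂*E`. -/
def essBdry {N : ℕ} (E : Set (RN N)) : Set (RN N) :=
  {x | ¬ hasDensity E x 0 ∧ ¬ hasDensity E x 1}

/-- The boundary `∂⁻E`. -/
def minusBdry {N : ℕ} (E : Set (RN N)) : Set (RN N) :=
  {x | ∀ r : ℝ, 0 < r → 0 < volume (E ∩ ball x r) ∧ volume (E ∩ ball x r) < volume (ball x r)}

/-- Approximate liminf `u⁻`. -/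
def aliminf {N : ℕ} (u : RN N → ℝ) (x : RN N) : EReal :=
  sSup {t : EReal | hasDensity {y | ((u y : EReal)) < t} x 0}

/-- Approximate limsup `u⁺`. -/
def alimsup {N : ℕ} (u : RN N → ℝ) (x : RN N) : EReal :=
  sInf {t : EReal | hasDensity {y | t < ((u y : EReal))} x 0}

/-- The `λ`-representative `u^λ = (1-λ)u⁻ + λu⁺`, with the convention
`u^λ = (2λ-1)·(+∞)` (and `0·∞ = 0`) on `Z_u = {u⁺ = +∞, u⁻ = -∞}`. -/
def lrep {N : ℕ} (u lam : RN N → ℝ) (x : RN N) : EReal :=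
  if alimsup u x = ⊤ ∧ aliminf u x = ⊥ then ((2 * lam x - 1 : ℝ) : EReal) * (⊤ : EReal)
  else ((1 - lam x : ℝ) : EReal) * aliminf u x + ((lam x : ℝ) : EReal) * alimsup u x

/-- `lam` is a Borel function with values in `[0,1]`. -/
def IsLam {N : ℕ} (lam : RN N → ℝ) : Prop :=
  Measurable lam ∧ ∀ x, lam x ∈ Icc (0:ℝ) 1

/-- An extended-real valued function belongs to `L¹(μ)`. -/
def Fin1 {N : ℕ} (f : RN N → EReal) (μ : Measure (RN N)) : Prop :=
  (∀ᵐ x ∂μ, f x ≠ ⊤ ∧ f x ≠ ⊥) ∧ Integrable (fun x => (f x).toReal) μ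

/-- An extended-real valued function belongs to `L¹_loc(Ω, μ)`. -/
def Fin1loc {N : ℕ} (Ω : Set (RN N)) (f : RN N → EReal) (μ : Measure (RN N)) : Prop :=
  ∀ K : Set (RN N), IsCompact K → K ⊆ Ω →
    (∀ᵐ x ∂μ.restrict K, f x ≠ ⊤ ∧ f x ≠ ⊥) ∧
    IntegrableOn (fun x => (f x).toReal) K μ

/-- The `λ`-pairing distribution `⟨(A,Du)_λ, φ⟩`. -/
def pairing {N : ℕ} {Ω : Set (RN N)} (A : Fin N → LocM N Ω) (σ : LocM N Ω)
    (u lam : RN N → ℝ) (φ : RN N → ℝ) : ℝ :=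
  - σ.intg (fun x => (lrep u lam x).toReal * φ x)
  - ∑ i, (A i).intg (fun x => (lrep u lam x).toReal * gradComp φ i x)

/-- `u ∈ X_loc^{A,λ}(Ω)`. -/
def XlocMem {N : ℕ} {Ω : Set (RN N)} (A : Fin N → LocM N Ω) (σ : LocM N Ω)
    (u lam : RN N → ℝ) : Prop :=
  Fin1loc Ω (lrep u lam) (varSum A) ∧ Fin1loc Ω (lrep u lam) σ.var

/-- `χ_E^λ = χ_{E¹} + λ χ_{∂*E}`. -/
def chiLam {N : ℕ} (E : Set (RN N)) (lam : RN N → ℝ) (x : RN N) : ℝ :=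
  (densOne E).indicator (fun _ => (1:ℝ)) x + lam x * (essBdry E).indicator (fun _ => (1:ℝ)) x

/-- The `λ`-pairing distribution `⟨(A,Dχ_E)_λ, φ⟩`. -/
def pairingSet {N : ℕ} {Ω : Set (RN N)} (A : Fin N → LocM N Ω) (σ : LocM N Ω)
    (E : Set (RN N)) (lam : RN N → ℝ) (φ : RN N → ℝ) : ℝ :=
  - σ.intg (fun x => chiLam E lam x * φ x)
  - ∑ i, (A i).intg (fun x => chiLam E lam x * gradComp φ i x)

/-- The support of a (nonnegative) measure. -/
def msupp {N : ℕ} (μ : Measure (RN N)) : Set (RN N) := {x | ∀ U ∈ 𝓝 x, μ U ≠ 0}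

/-- The measure `|A|·L^N` of a density field `a`. -/
def vmeas {N : ℕ} (Ω : Set (RN N)) (a : RN N → RN N) : Measure (RN N) :=
  (volume.restrict Ω).withDensity (fun x => (‖a x‖₊ : ℝ≥0∞))

/-- `σ` is the distributional divergence on `Ω` of the `L¹_loc` field `a`. -/
def IsDivergenceD {N : ℕ} (Ω : Set (RN N)) (a : RN N → RN N) (σ : LocM N Ω) : Prop :=
  ∀ φ : RN N → ℝ, IsTest Ω φ → σ.intg φ = - ∫ x in Ω, fderiv ℝ φ x (a x)

/-- The `λ`-pairing for a density field `a`. -/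
def pairingD {N : ℕ} (Ω : Set (RN N)) (a : RN N → RN N) (σ : LocM N Ω)
    (u lam φ : RN N → ℝ) : ℝ :=
  - σ.intg (fun x => (lrep u lam x).toReal * φ x)
  - ∫ x in Ω, (lrep u lam x).toReal * fderiv ℝ φ x (a x)

/-- The set `λ`-pairing for a density field `a`. -/
def pairingSetD {N : ℕ} (Ω : Set (RN N)) (a : RN N → RN N) (σ : LocM N Ω)
    (E : Set (RN N)) (lam φ : RN N → ℝ) : ℝ :=
  - σ.intg (fun x => chiLam E lam x * φ x)
  - ∫ x in Ω, chiLam E lam x * fderiv ℝ φ x (a x)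

/-- `u ∈ X_loc^{A,λ}(Ω)` for a density field. -/
def XlocMemD {N : ℕ} (Ω : Set (RN N)) (a : RN N → RN N) (σ : LocM N Ω)
    (u lam : RN N → ℝ) : Prop :=
  Fin1loc Ω (lrep u lam) (vmeas Ω a) ∧ Fin1loc Ω (lrep u lam) σ.var

/-- `u ∈ BV_loc^{A,λ}(Ω)` for a density field. -/
def BVlocD {N : ℕ} (Ω : Set (RN N)) (a : RN N → RN N) (σ : LocM N Ω)
    (u lam : RN N → ℝ) : Prop :=
  XlocMemD Ω a σ u lam ∧
  ∃ μ : LocM N Ω, ∀ φ, IsTest Ω φ → pairingD Ω a σ u lam φ = μ.intg φ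

section Density

variable {N : ℕ} {E F : Set (RN N)} {x : RN N}

/-- The fraction of the ball `B_r(x)` occupied by `E`. -/
def ballRatio (E : Set (RN N)) (x : RN N) (r : ℝ) : ℝ :=
  (volume (E ∩ ball x r)).toReal / (volume (ball x r)).toReal

lemma toReal_volume_ball_pos (x : RN N) {r : ℝ} (hr : 0 < r) :
    0 < (volume (ball x r)).toReal :=
  ENNReal.toReal_pos (measure_ball_pos volume x hr).ne' measure_ball_lt_top.ne

lemma volume_inter_ball_ne_top (E : Set (RN N)) (x : RN N) (r : ℝ) :
    volume (E ∩ ball x r) ≠ ⊤ :=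
  measure_ne_top_of_subset inter_subset_right measure_ball_lt_top.ne

lemma hasDensity_unique {a b : ℝ} (ha : hasDensity E x a) (hb : hasDensity E x b) : a = b :=
  tendsto_nhds_unique ha hb

lemma hasDensity_le_one {d : ℝ} (h : hasDensity E x d) : d ≤ 1 := by
  refine le_of_tendsto h (Eventually.of_forall fun r => ?_)
  exact div_le_one_of_le₀
    (ENNReal.toReal_mono measure_ball_lt_top.ne (measure_mono inter_subset_right))
    ENNReal.toReal_nonneg

lemma ballRatio_union (hF : MeasurableSet F) (hEF : volume (E ∩ F) = 0) (x : RN N) (r : ℝ) :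
    ballRatio (E ∪ F) x r = ballRatio E x r + ballRatio F x r := by
  have h : AEDisjoint volume (E ∩ ball x r) (F ∩ ball x r) :=
    measure_mono_null (inter_subset_inter inter_subset_left inter_subset_left) hEF
  rw [ballRatio, ballRatio, ballRatio, union_inter_distrib_right,
    measure_union₀ (hF.inter measurableSet_ball).nullMeasurableSet h,
    ENNReal.toReal_add (volume_inter_ball_ne_top E x r) (volume_inter_ball_ne_top F x r), add_div]

lemma hasDensity_union {a b : ℝ} (hF : MeasurableSet F) (hEF : volume (E ∩ F) = 0)
    (ha : hasDensity E x a) (hb : hasDensity F x b) : hasDensity (E ∪ F) x (a + b) := by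
  have h : Tendsto (fun r => ballRatio E x r + ballRatio F x r) (𝓝[>] 0) (𝓝 (a + b)) := ha.add hb
  exact h.congr fun r => (ballRatio_union hF hEF x r).symm

lemma hasDensity_union_iff {d : ℝ} (hF : MeasurableSet F) (hEF : volume (E ∩ F) = 0)
    (hb : hasDensity F x 0) : hasDensity (E ∪ F) x d ↔ hasDensity E x d := by
  refine ⟨fun h => ?_, fun h => by simpa using hasDensity_union hF hEF h hb⟩
  have h' : Tendsto (fun r => ballRatio (E ∪ F) x r - ballRatio F x r) (𝓝[>] 0) (𝓝 (d - 0)) :=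
    Tendsto.sub h hb
  rw [sub_zero] at h'
  exact h'.congr fun r => by rw [ballRatio_union hF hEF, add_sub_cancel_right]; rfl

lemma chiLam_congr {E F : Set (RN N)} (lam : RN N → ℝ)
    (h : ∀ d, hasDensity E x d ↔ hasDensity F x d) : chiLam E lam x = chiLam F lam x := by
  have h1 : x ∈ densOne E ↔ x ∈ densOne F := h 1
  have hb : x ∈ essBdry E ↔ x ∈ essBdry F := and_congr (h 0).not (h 1).not
  classical
  simp only [chiLam, indicator_apply, h1, hb]

lemma chiLam_of_hasDensity_zero (lam : RN N → ℝ) (h : hasDensity E x 0) :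
    chiLam E lam x = 0 := by
  have h1 : ¬ hasDensity E x 1 := fun h1 => zero_ne_one (hasDensity_unique h h1)
  simp [chiLam, densOne, essBdry, h, h1]

lemma chiLam_of_hasDensity_one (lam : RN N → ℝ) (h : hasDensity E x 1) :
    chiLam E lam x = 1 := by
  simp [chiLam, densOne, essBdry, h]

lemma chiLam_union_of_hasDensity_zero (lam : RN N → ℝ) (hF : MeasurableSet F)
    (hEF : volume (E ∩ F) = 0) (hb : hasDensity F x 0) :
    chiLam (E ∪ F) lam x = chiLam E lam x + chiLam F lam x := by
  rw [chiLam_of_hasDensity_zero lam hb, add_zero]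
  exact chiLam_congr lam fun d => hasDensity_union_iff hF hEF hb

lemma chiLam_union (lam : RN N → ℝ) (hE : MeasurableSet E) (hF : MeasurableSet F)
    (hEF : volume (E ∩ F) = 0)
    (hb1 : essBdry E ∩ densOne F = ∅) (hb2 : essBdry F ∩ densOne E = ∅)
    (hb3 : essBdry E ∩ essBdry F = ∅) (x : RN N) :
    chiLam (E ∪ F) lam x = chiLam E lam x + chiLam F lam x := by
  by_cases hF0 : hasDensity F x 0
  · exact chiLam_union_of_hasDensity_zero lam hF hEF hF0
  have hE0 : hasDensity E x 0 := by
    by_contra hE0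
    by_cases hE1 : hasDensity E x 1 <;> by_cases hF1 : hasDensity F x 1
    · have := hasDensity_le_one (hasDensity_union hF hEF hE1 hF1)
      norm_num at this
    · exact eq_empty_iff_forall_notMem.1 hb2 x ⟨⟨hF0, hF1⟩, hE1⟩
    · exact eq_empty_iff_forall_notMem.1 hb1 x ⟨⟨hE0, hE1⟩, hF1⟩
    · exact eq_empty_iff_forall_notMem.1 hb3 x ⟨⟨hE0, hE1⟩, hF0, hF1⟩
  rw [union_comm, add_comm]
  exact chiLam_union_of_hasDensity_zero lam hE (by rwa [inter_comm]) hE0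

lemma tendsto_ballRatio {q : ℕ → ℝ} {r : ℝ} (hr : 0 < r) (hq : Monotone q)
    (hlt : ∀ n, q n < r) (hlim : Tendsto q atTop (𝓝 r)) (E : Set (RN N)) (x : RN N) :
    Tendsto (fun n => ballRatio E x (q n)) atTop (𝓝 (ballRatio E x r)) := by
  have key : ∀ G : Set (RN N), Tendsto (fun n => (volume (G ∩ ball x (q n))).toReal) atTop
      (𝓝 (volume (G ∩ ball x r)).toReal) := by
    intro G
    have hU : ⋃ n, G ∩ ball x (q n) = G ∩ ball x r := by
      rw [← inter_iUnion]
      congr 1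
      refine Subset.antisymm (iUnion_subset fun n => ball_subset_ball (hlt n).le) fun y hy => ?_
      obtain ⟨n, hn⟩ := (hlim.eventually (lt_mem_nhds (mem_ball.1 hy))).exists
      exact mem_iUnion.2 ⟨n, hn⟩
    have hmono : Monotone fun n => G ∩ ball x (q n) := fun m n hmn =>
      inter_subset_inter_right _ (ball_subset_ball (hq hmn))
    have := tendsto_measure_iUnion_atTop (μ := volume) hmono
    rw [hU] at this
    exact (ENNReal.tendsto_toReal (volume_inter_ball_ne_top G x r)).comp this
  have hball := key univ
  simp only [univ_inter] at hball
  exact (key E).div hball (toReal_volume_ball_pos x hr).ne'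

lemma hasDensity_iff_rat {d : ℝ} :
    hasDensity E x d ↔ ∀ k : ℕ, ∃ m : ℕ, ∀ q : ℚ, 0 < (q : ℝ) → (q : ℝ) < 1 / (m + 1 : ℝ) →
      |ballRatio E x q - d| ≤ 1 / (k + 1 : ℝ) := by
  have hdef : hasDensity E x d ↔ Tendsto (ballRatio E x) (𝓝[>] 0) (𝓝 d) := Iff.rfl
  rw [hdef, Metric.tendsto_nhdsWithin_nhds]
  constructor
  · intro h k
    obtain ⟨δ, hδ, h⟩ := h (1 / (k + 1 : ℝ)) (by positivity)
    obtain ⟨m, hm⟩ := exists_nat_one_div_lt hδ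
    refine ⟨m, fun q hq0 hqm => ?_⟩
    have := h (x := (q : ℝ)) hq0 (by rw [Real.dist_eq, sub_zero, abs_of_pos hq0]; linarith)
    rw [Real.dist_eq] at this
    exact this.le
  · intro h ε hε
    obtain ⟨k, hk⟩ := exists_nat_one_div_lt hε
    obtain ⟨m, hm⟩ := h k
    refine ⟨1 / (m + 1 : ℝ), by positivity, fun r hr0 hrm => ?_⟩
    have hr : 0 < r := hr0
    rw [Real.dist_eq, sub_zero, abs_of_pos hr] at hrm
    obtain ⟨q, hq, hqr, hlim⟩ := Real.exists_seq_rat_strictMono_tendsto r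
    have ht := tendsto_ballRatio hr
      (Rat.cast_mono (K := ℝ) |>.comp hq.monotone) hqr hlim E x
    have hle : |ballRatio E x r - d| ≤ 1 / (k + 1 : ℝ) := by
      refine le_of_tendsto (ht.sub_const d).abs ?_
      filter_upwards [hlim.eventually (lt_mem_nhds hr)] with n hn
      exact hm (q n) hn ((hqr n).trans hrm)
    rw [Real.dist_eq]
    exact hle.trans_lt hk

lemma measurable_volume_inter_ball (hE : MeasurableSet E) (r : ℝ) :
    Measurable fun x => volume (E ∩ ball x r) := by
  have hs : MeasurableSet {p : RN N × RN N | p.2 ∈ E ∧ dist p.2 p.1 < r} :=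
    (measurable_snd hE).inter
      (isOpen_lt (continuous_snd.dist continuous_fst) continuous_const).measurableSet
  exact measurable_measure_prodMk_left (ν := volume) hs

lemma measurable_ballRatio (hE : MeasurableSet E) (r : ℝ) :
    Measurable fun x => ballRatio E x r := by
  have h := measurable_volume_inter_ball (N := N) MeasurableSet.univ r
  simp only [univ_inter] at h
  exact (measurable_volume_inter_ball hE r).ennreal_toReal.div h.ennreal_toReal

lemma measurableSet_hasDensity (hE : MeasurableSet E) (d : ℝ) :
    MeasurableSet {x | hasDensity E x d} := by
  simp only [hasDensity_iff_rat, ofPred_forall, ofPred_exists]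
  refine .iInter fun k => .iUnion fun m => .iInter fun q => .iInter fun _ => .iInter fun _ => ?_
  exact measurableSet_le ((measurable_ballRatio hE q).sub_const d).abs measurable_const

lemma measurable_chiLam (hE : MeasurableSet E) {lam : RN N → ℝ} (hlam : Measurable lam) :
    Measurable (chiLam E lam) := by
  have h1 := measurableSet_hasDensity hE 1
  have hb : MeasurableSet (essBdry E) := (measurableSet_hasDensity hE 0).compl.inter h1.compl
  exact (measurable_const.indicator h1).add (hlam.mul (measurable_const.indicator hb))

lemma norm_chiLam_le (E : Set (RN N)) {lam : RN N → ℝ} (hlam : IsLam lam) (x : RN N) :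
    ‖chiLam E lam x‖ ≤ 2 := by
  obtain ⟨h0, h1⟩ := hlam.2 x
  rw [Real.norm_eq_abs, abs_le]
  by_cases hd : x ∈ densOne E <;> by_cases hb : x ∈ essBdry E <;> simp [chiLam, hd, hb] <;>
    first | linarith | (constructor <;> linarith)

/-- Off `∂⁻E`, the set `E` has locally constant density `0` or `1`. -/
lemma exists_ball_chiLam_eq_const (hE : MeasurableSet E) (lam : RN N → ℝ)
    (hx : x ∉ minusBdry E) :
    ∃ r > 0, ∃ c : ℝ, ∀ y ∈ ball x r, chiLam E lam y = c := by
  simp only [minusBdry, mem_ofPred_eq, not_forall, not_and_or, not_lt] at hx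
  obtain ⟨r, hr, h⟩ := hx
  have hsmall : ∀ y ∈ ball x r, ∀ᶠ s in 𝓝[>] (0 : ℝ), 0 < s ∧ ball y s ⊆ ball x r := by
    intro y hy
    obtain ⟨ε, hε, hsub⟩ := Metric.isOpen_iff.1 isOpen_ball y hy
    filter_upwards [Ioo_mem_nhdsGT hε] with s hs
    exact ⟨hs.1, (ball_subset_ball hs.2.le).trans hsub⟩
  refine ⟨r, hr, ?_⟩
  rcases h with h | h
  · refine ⟨0, fun y hy => chiLam_of_hasDensity_zero lam ?_⟩
    refine tendsto_const_nhds.congr' ?_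
    filter_upwards [hsmall y hy] with s hs
    rw [measure_mono_null (inter_subset_inter_right E hs.2) (nonpos_iff_eq_zero.1 h)]
    simp
  · refine ⟨1, fun y hy => chiLam_of_hasDensity_one lam ?_⟩
    have hnull : volume (ball x r \ E) = 0 := by
      rw [← sdiff_inter_self_eq_sdiff, measure_sdiff inter_subset_right
        (hE.inter measurableSet_ball).nullMeasurableSet (volume_inter_ball_ne_top E x r),
        tsub_eq_zero_of_le h]
    refine tendsto_const_nhds.congr' ?_
    filter_upwards [hsmall y hy] with s hs
    have : volume (E ∩ ball y s) = volume (ball y s) := by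
      refine le_antisymm (measure_mono inter_subset_right) ?_
      have hd : volume (ball y s \ E) = 0 :=
        measure_mono_null (sdiff_subset_sdiff_left hs.2) hnull
      rw [inter_comm, ← measure_inter_add_sdiff (ball y s) hE, hd, add_zero]
    rw [this, div_self (toReal_volume_ball_pos y hs.1).ne']

end Density

section Radon

variable {N : ℕ} {Ω U : Set (RN N)} {μ ν : Measure (RN N)}

lemma sigmaFinite_of_locallyFinite_on (hΩ : μ Ωᶜ = 0) (h : ∀ x ∈ Ω, ∃ s ∈ 𝓝 x, μ s < ⊤) :
    SigmaFinite μ := by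
  choose! f hf hfin using h
  obtain ⟨t, htΩ, htc, hcov⟩ := TopologicalSpace.countable_cover_nhdsWithin (s := Ω)
    fun x hx => mem_nhdsWithin_of_mem_nhds (hf x hx)
  refine Measure.sigmaFinite_of_countable (S := insert Ωᶜ (f '' t)) ((htc.image f).insert _) ?_ ?_
  · rintro s (rfl | ⟨x, hx, rfl⟩)
    · simp [hΩ]
    · exact hfin x (htΩ hx)
  · refine eq_univ_of_forall fun x => ?_
    by_cases hx : x ∈ Ω
    · obtain ⟨y, hy, hxy⟩ := mem_iUnion₂.1 (hcov hx)
      exact ⟨f y, .inr (mem_image_of_mem f hy), hxy⟩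
    · exact ⟨Ωᶜ, .inl rfl, hx⟩

lemma measure_lt_top_of_isCompact (h : ∀ x ∈ Ω, ∃ s ∈ 𝓝 x, μ s < ⊤) {K : Set (RN N)}
    (hK : IsCompact K) (hKΩ : K ⊆ Ω) : μ K < ⊤ :=
  hK.measure_lt_top_of_nhdsWithin fun x hx => by
    obtain ⟨s, hs, hfin⟩ := h x (hKΩ hx)
    exact ⟨s, mem_nhdsWithin_of_mem_nhds hs, hfin⟩

lemma integrable_mul_of_tsupport_subset (h : ∀ x ∈ Ω, ∃ s ∈ 𝓝 x, μ s < ⊤) {g φ : RN N → ℝ}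
    {C : ℝ} (hg : Measurable g) (hgC : ∀ x, ‖g x‖ ≤ C) (hφ : Continuous φ)
    (hc : HasCompactSupport φ) (hs : tsupport φ ⊆ Ω) : Integrable (fun x => g x * φ x) μ := by
  have hφi : Integrable φ μ := by
    rw [← integrableOn_iff_integrable_of_support_subset (subset_tsupport φ)]
    exact hφ.continuousOn.integrableOn_of_subset_isCompact hc (isClosed_tsupport φ).measurableSet
      Subset.rfl (measure_lt_top_of_isCompact h hc hs).ne
  exact hφi.bdd_mul hg.aestronglyMeasurable (.of_forall hgC)

/-- Measures that are finite on compact subsets of an open set `U` and integrate the test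
functions of `U` to the same values agree on `U`. -/
lemma restrict_eq_of_integral_isTest_eq [SigmaFinite μ] [SigmaFinite ν] (hU : IsOpen U)
    (hμ : ∀ x ∈ U, ∃ s ∈ 𝓝 x, μ s < ⊤) (hν : ∀ x ∈ U, ∃ s ∈ 𝓝 x, ν s < ⊤)
    (h : ∀ φ, IsTest U φ → ∫ x, φ x ∂μ = ∫ x, φ x ∂ν) : μ.restrict U = ν.restrict U := by
  set m := μ + ν with hm
  have hμm : μ ≪ m := Measure.absolutelyContinuous_of_le (Measure.le_add_right le_rfl)
  have hνm : ν ≪ m := Measure.absolutelyContinuous_of_le (Measure.le_add_left le_rfl)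
  have hloc : ∀ ρ : Measure (RN N), (∀ x ∈ U, ∃ s ∈ 𝓝 x, ρ s < ⊤) →
      LocallyIntegrableOn (fun x => (ρ.rnDeriv m x).toReal) U m := by
    intro ρ hρ
    rw [locallyIntegrableOn_iff hU.isLocallyClosed]
    exact fun K hKU hK => Measure.integrableOn_toReal_rnDeriv
      (measure_lt_top_of_isCompact hρ hK hKU).ne
  have hint : ∀ ρ : Measure (RN N), (∀ x ∈ U, ∃ s ∈ 𝓝 x, ρ s < ⊤) → ∀ φ, IsTest U φ →
      Integrable (fun x => φ x * (ρ.rnDeriv m x).toReal) m := by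
    intro ρ hρ φ hφ
    obtain ⟨h1, h2, h3⟩ := hφ
    rw [← integrableOn_iff_integrable_of_support_subset (s := tsupport φ)
      (fun x hx => subset_tsupport φ (left_ne_zero_of_mul hx))]
    exact (Measure.integrableOn_toReal_rnDeriv
      (measure_lt_top_of_isCompact hρ h2 h3).ne).continuousOn_mul h1.continuous.continuousOn h2
  have hae := hU.ae_eq_zero_of_integral_contDiff_smul_eq_zero ((hloc μ hμ).sub (hloc ν hν))
    fun φ h1 h2 h3 => by
      have hφ : IsTest U φ := ⟨h1, h2, h3⟩
      simp only [Pi.sub_apply, smul_eq_mul, mul_sub]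
      rw [integral_sub (hint μ hμ φ hφ) (hint ν hν φ hφ)]
      simp_rw [mul_comm (φ _)]
      rw [integral_toReal_rnDeriv_mul hμm, integral_toReal_rnDeriv_mul hνm, h φ hφ, sub_self]
  rw [← Measure.withDensity_rnDeriv_eq μ m hμm, ← Measure.withDensity_rnDeriv_eq ν m hνm,
    restrict_withDensity hU.measurableSet, restrict_withDensity hU.measurableSet]
  refine withDensity_congr_ae ?_
  rw [EventuallyEq, ae_restrict_iff' hU.measurableSet]
  filter_upwards [hae, μ.rnDeriv_lt_top m, ν.rnDeriv_lt_top m] with x hx hx1 hx2 hxU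
  exact (ENNReal.toReal_eq_toReal_iff' hx1.ne hx2.ne).1 (sub_eq_zero.1 (hx hxU))

end Radon

section Jordan

variable {α : Type*} [MeasurableSpace α] {P Q p q : Measure α}

lemma le_of_le_add_of_mutuallySingular (hPQ : P ⟂ₘ Q) (h : P ≤ Q + p) : P ≤ p := by
  obtain ⟨s, hs, hPs, hQs⟩ := hPQ
  refine Measure.le_iff.2 fun t _ => ?_
  calc P t ≤ P (t ∩ s) + P (t \ s) := measure_le_inter_add_sdiff P t s
    _ = P (t \ s) := by rw [measure_mono_null inter_subset_right hPs, zero_add]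
    _ ≤ Q (t \ s) + p (t \ s) := h _
    _ = p (t \ s) := by
      rw [measure_mono_null (fun _ hx => hx.2 : t \ s ⊆ sᶜ) hQs, zero_add]
    _ ≤ p t := measure_mono sdiff_subset

/-- Uniqueness of the Jordan decomposition, without finiteness assumptions. -/
lemma eq_of_add_eq_add_of_mutuallySingular (hPQ : P ⟂ₘ Q) (hpq : p ⟂ₘ q)
    (h : P + q = Q + p) : P = p ∧ Q = q := by
  refine ⟨le_antisymm ?_ ?_, le_antisymm ?_ ?_⟩
  · exact le_of_le_add_of_mutuallySingular hPQ (h ▸ Measure.le_add_right le_rfl)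
  · exact le_of_le_add_of_mutuallySingular hpq
      (add_comm P q ▸ h ▸ Measure.le_add_left le_rfl)
  · exact le_of_le_add_of_mutuallySingular hPQ.symm (h ▸ Measure.le_add_right le_rfl)
  · exact le_of_le_add_of_mutuallySingular hpq.symm
      (add_comm Q p ▸ h ▸ Measure.le_add_left le_rfl)

end Jordan

namespace LocM

variable {N : ℕ} {Ω U : Set (RN N)} (μ : LocM N Ω)

instance : SigmaFinite μ.pos := sigmaFinite_of_locallyFinite_on μ.posNull μ.posLoc

instance : SigmaFinite μ.neg := sigmaFinite_of_locallyFinite_on μ.negNull μ.negLoc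

lemma intg_add {f g : RN N → ℝ} (hf : Integrable f μ.pos) (hf' : Integrable f μ.neg)
    (hg : Integrable g μ.pos) (hg' : Integrable g μ.neg) :
    μ.intg (fun x => f x + g x) = μ.intg f + μ.intg g := by
  rw [intg, intg, intg, integral_add hf hg, integral_add hf' hg']
  ring

lemma intg_const_mul (c : ℝ) (f : RN N → ℝ) : μ.intg (fun x => c * f x) = c * μ.intg f := by
  rw [intg, intg, integral_const_mul, integral_const_mul, mul_sub]

lemma var_eq_zero_of_intg_isTest_eq_zero (hU : IsOpen U) (hUΩ : U ⊆ Ω)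
    (h : ∀ φ, IsTest U φ → μ.intg φ = 0) : μ.var U = 0 := by
  have heq : μ.pos.restrict U = μ.neg.restrict U :=
    restrict_eq_of_integral_isTest_eq hU (fun x hx => μ.posLoc x (hUΩ hx))
      (fun x hx => μ.negLoc x (hUΩ hx)) fun φ hφ => sub_eq_zero.1 (h φ hφ)
  have hs : μ.pos.restrict U ⟂ₘ μ.neg.restrict U :=
    (μ.singular.restrict U).symm.restrict U |>.symm
  have hp : μ.pos.restrict U = 0 := Measure.MutuallySingular.self_iff _ |>.1 (by rwa [← heq] at hs)
  have hn : μ.neg.restrict U = 0 := heq ▸ hp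
  rw [Measure.restrict_eq_zero] at hp hn
  simp [var, hp, hn]

end LocM

section Pairing

variable {N : ℕ} {Ω U : Set (RN N)} {φ : RN N → ℝ}

lemma IsTest.isTest1 (h : IsTest Ω φ) : IsTest1 Ω φ := ⟨h.1.of_le (by simp), h.2⟩

lemma IsTest.mono (h : IsTest U φ) (hUΩ : U ⊆ Ω) : IsTest Ω φ := ⟨h.1, h.2.1, h.2.2.trans hUΩ⟩

lemma continuous_gradComp (h : IsTest1 Ω φ) (i : Fin N) : Continuous (gradComp φ i) :=
  (h.1.continuous_fderiv one_ne_zero).clm_apply continuous_const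

lemma tsupport_gradComp_subset (φ : RN N → ℝ) (i : Fin N) :
    tsupport (gradComp φ i) ⊆ tsupport φ :=
  tsupport_fderiv_apply_subset ℝ _

lemma hasCompactSupport_gradComp (h : HasCompactSupport φ) (i : Fin N) :
    HasCompactSupport (gradComp φ i) :=
  h.mono' ((subset_tsupport _).trans (tsupport_gradComp_subset φ i))

lemma LocM.intg_chiLam_union_mul (μ : LocM N Ω) {lam : RN N → ℝ} (hlam : IsLam lam)
    {E F : Set (RN N)} (hE : MeasurableSet E) (hF : MeasurableSet F)
    (hadd : ∀ x, chiLam (E ∪ F) lam x = chiLam E lam x + chiLam F lam x)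
    (hφ : Continuous φ) (hc : HasCompactSupport φ) (hs : tsupport φ ⊆ Ω) :
    μ.intg (fun x => chiLam (E ∪ F) lam x * φ x)
      = μ.intg (fun x => chiLam E lam x * φ x) + μ.intg (fun x => chiLam F lam x * φ x) := by
  have hint : ∀ G : Set (RN N), MeasurableSet G → ∀ ρ : Measure (RN N),
      (∀ x ∈ Ω, ∃ s ∈ 𝓝 x, ρ s < ⊤) → Integrable (fun x => chiLam G lam x * φ x) ρ :=
    fun G hG ρ hρ => integrable_mul_of_tsupport_subset hρ (measurable_chiLam hG hlam.1)
      (norm_chiLam_le G hlam) hφ hc hs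
  simp only [hadd, add_mul]
  exact μ.intg_add (hint E hE _ μ.posLoc) (hint E hE _ μ.negLoc) (hint F hF _ μ.posLoc)
    (hint F hF _ μ.negLoc)

lemma pairingSet_union (A : Fin N → LocM N Ω) (σ : LocM N Ω) {lam : RN N → ℝ} (hlam : IsLam lam)
    {E F : Set (RN N)} (hE : MeasurableSet E) (hF : MeasurableSet F)
    (hadd : ∀ x, chiLam (E ∪ F) lam x = chiLam E lam x + chiLam F lam x) (hφ : IsTest1 Ω φ) :
    pairingSet A σ (E ∪ F) lam φ = pairingSet A σ E lam φ + pairingSet A σ F lam φ := by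
  have hσ := σ.intg_chiLam_union_mul hlam hE hF hadd hφ.1.continuous hφ.2.1 hφ.2.2
  have hA := fun i => (A i).intg_chiLam_union_mul hlam hE hF hadd (continuous_gradComp hφ i)
    (hasCompactSupport_gradComp hφ.2.1 i) ((tsupport_gradComp_subset φ i).trans hφ.2.2)
  simp only [pairingSet, hσ, hA, Finset.sum_add_distrib]
  ring

lemma pairingSet_eq_zero_of_chiLam_eq_const {A : Fin N → LocM N Ω} {σ : LocM N Ω}
    (hdiv : IsDivergence Ω A σ) {lam : RN N → ℝ} {E : Set (RN N)} {c : ℝ}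
    (hc : ∀ x ∈ U, chiLam E lam x = c) (hUΩ : U ⊆ Ω) (hφ : IsTest U φ) :
    pairingSet A σ E lam φ = 0 := by
  have hmul : ∀ g : RN N → ℝ, tsupport g ⊆ tsupport φ →
      (fun x => chiLam E lam x * g x) = fun x => c * g x := by
    intro g hg
    funext x
    by_cases hx : x ∈ tsupport g
    · rw [hc x (hφ.2.2 (hg hx))]
    · rw [image_eq_zero_of_notMem_tsupport hx, mul_zero, mul_zero]
  simp only [pairingSet, hmul φ Subset.rfl, hmul _ (tsupport_gradComp_subset φ _),
    LocM.intg_const_mul, ← Finset.mul_sum, hdiv φ (hφ.mono hUΩ)]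
  ring

/-- A measure representing the pairing of `χ_E` is concentrated on `∂⁻E`. -/
lemma LocM.var_compl_minusBdry_eq_zero {A : Fin N → LocM N Ω} {σ : LocM N Ω} (hΩ : IsOpen Ω)
    (hdiv : IsDivergence Ω A σ) {lam : RN N → ℝ} {E : Set (RN N)} (hE : MeasurableSet E)
    (μ : LocM N Ω) (h : ∀ φ, IsTest Ω φ → pairingSet A σ E lam φ = μ.intg φ) :
    μ.var (minusBdry E)ᶜ = 0 := by
  have hnull : μ.var Ωᶜ = 0 := by simp [LocM.var, μ.posNull, μ.negNull]
  have hloc : μ.var (Ω \ minusBdry E) = 0 := by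
    refine measure_null_of_locally_null _ fun x ⟨hxΩ, hx⟩ => ?_
    obtain ⟨r, hr, c, hc⟩ := exists_ball_chiLam_eq_const hE lam hx
    refine ⟨ball x r ∩ Ω, mem_nhdsWithin_of_mem_nhds
      (inter_mem (ball_mem_nhds x hr) (hΩ.mem_nhds hxΩ)), ?_⟩
    refine μ.var_eq_zero_of_intg_isTest_eq_zero (isOpen_ball.inter hΩ) inter_subset_right
      fun φ hφ => ?_
    rw [← h φ (hφ.mono inter_subset_right)]
    exact pairingSet_eq_zero_of_chiLam_eq_const hdiv (fun y hy => hc y hy.1)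
      inter_subset_right hφ
  refine measure_mono_null (fun x hx => ?_) (measure_union_null hnull hloc)
  by_cases hxΩ : x ∈ Ω
  · exact .inr ⟨hxΩ, hx⟩
  · exact .inl hxΩ

end Pairing

/-- additivity of the set `λ`-pairing on essentially disjoint sets,
and additivity of the total variations when `∂⁻E ∩ ∂⁻F = ∅`. -/
theorem stmt13 {N : ℕ} (Ω : Set (RN N)) (hΩ : IsOpen Ω)
    (A : Fin N → LocM N Ω) (σ : LocM N Ω) (hdiv : IsDivergence Ω A σ)
    (lam : RN N → ℝ) (hlam : IsLam lam)
    (E F : Set (RN N)) (hE : MeasurableSet E) (hF : MeasurableSet F)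
    (hEΩ : E ⊆ Ω) (hFΩ : F ⊆ Ω)
    (hEF : volume (E ∩ F) = 0)
    (hb1 : essBdry E ∩ densOne F = ∅) (hb2 : essBdry F ∩ densOne E = ∅)
    (hb3 : essBdry E ∩ essBdry F = ∅) :
    (∀ φ, IsTest1 Ω φ →
      pairingSet A σ (E ∪ F) lam φ
        = pairingSet A σ E lam φ + pairingSet A σ F lam φ) ∧
    (∀ μE μF μEF : LocM N Ω,
      (∀ φ, IsTest Ω φ → pairingSet A σ E lam φ = μE.intg φ) →
      (∀ φ, IsTest Ω φ → pairingSet A σ F lam φ = μF.intg φ) →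
      (∀ φ, IsTest Ω φ → pairingSet A σ (E ∪ F) lam φ = μEF.intg φ) →
      minusBdry E ∩ minusBdry F = ∅ →
      μEF.var = μE.var + μF.var) := by
  have hadd := chiLam_union lam hE hF hEF hb1 hb2 hb3
  have hpair : ∀ φ, IsTest1 Ω φ → pairingSet A σ (E ∪ F) lam φ
      = pairingSet A σ E lam φ + pairingSet A σ F lam φ :=
    fun φ hφ => pairingSet_union A σ hlam hE hF hadd hφ
  refine ⟨hpair, fun μE μF μEF hμE hμF hμEF hdisj => ?_⟩
  have hvE := LocM.var_compl_minusBdry_eq_zero hΩ hdiv hE μE hμE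
  have hvF := LocM.var_compl_minusBdry_eq_zero hΩ hdiv hF μF hμF
  simp only [LocM.var, Measure.add_apply, add_eq_zero] at hvE hvF
  have hcover : univ ⊆ (minusBdry E)ᶜ ∪ (minusBdry F)ᶜ := by
    rw [← compl_inter, hdisj, compl_empty]
  have hsing : μE.pos + μF.pos ⟂ₘ μE.neg + μF.neg :=
    .add_left (.add_right μE.singular (.mk hvE.1 hvF.2 hcover))
      (.add_right (Measure.MutuallySingular.mk hvE.2 hvF.1 hcover).symm μF.singular)
  have hint : ∀ φ, IsTest Ω φ → ∀ ρ : Measure (RN N), (∀ x ∈ Ω, ∃ s ∈ 𝓝 x, ρ s < ⊤) →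
      Integrable φ ρ := by
    intro φ ⟨h1, h2, h3⟩ ρ hρ
    simpa using integrable_mul_of_tsupport_subset hρ (measurable_const (a := (1 : ℝ)))
      (fun _ => le_rfl) h1.continuous h2 h3
  have hloc : ∀ ρ τ : Measure (RN N), (∀ x ∈ Ω, ∃ s ∈ 𝓝 x, ρ s < ⊤) →
      (∀ x ∈ Ω, ∃ s ∈ 𝓝 x, τ s < ⊤) → ∀ x ∈ Ω, ∃ s ∈ 𝓝 x, (ρ + τ) s < ⊤ := by
    intro ρ τ hρ hτ x hx
    obtain ⟨s, hs, hs'⟩ := hρ x hx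
    obtain ⟨t, ht, ht'⟩ := hτ x hx
    exact ⟨s ∩ t, inter_mem hs ht, ENNReal.add_lt_top.2
      ⟨measure_lt_top_of_subset inter_subset_left hs'.ne,
        measure_lt_top_of_subset inter_subset_right ht'.ne⟩⟩
  have hp := hloc _ _ μE.posLoc μF.posLoc
  have hn := hloc _ _ μE.negLoc μF.negLoc
  have hrestrict : (μE.pos + μF.pos + μEF.neg).restrict Ω
      = (μE.neg + μF.neg + μEF.pos).restrict Ω := by
    refine restrict_eq_of_integral_isTest_eq hΩ (hloc _ _ hp μEF.negLoc) (hloc _ _ hn μEF.posLoc)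
      fun φ hφ => ?_
    have h := hpair φ hφ.isTest1
    rw [hμE φ hφ, hμF φ hφ, hμEF φ hφ, LocM.intg, LocM.intg, LocM.intg] at h
    have hi := hint φ hφ
    rw [integral_add_measure (hi _ hp) (hi _ μEF.negLoc),
      integral_add_measure (hi _ μE.posLoc) (hi _ μF.posLoc),
      integral_add_measure (hi _ hn) (hi _ μEF.posLoc),
      integral_add_measure (hi _ μE.negLoc) (hi _ μF.negLoc)]
    linarith
  have heq : μE.pos + μF.pos + μEF.neg = μE.neg + μF.neg + μEF.pos := by
    rw [Measure.restrict_eq_self_of_ae_mem, Measure.restrict_eq_self_of_ae_mem] at hrestrict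
    · exact hrestrict
    · change (μE.neg + μF.neg + μEF.pos) Ωᶜ = 0
      simp [μE.negNull, μF.negNull, μEF.posNull]
    · change (μE.pos + μF.pos + μEF.neg) Ωᶜ = 0
      simp [μE.posNull, μF.posNull, μEF.negNull]
  obtain ⟨h1, h2⟩ := eq_of_add_eq_add_of_mutuallySingular hsing μEF.singular heq
  rw [LocM.var, LocM.var, LocM.var, ← h1, ← h2]
  exact add_add_add_comm _ _ _ _
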